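/- arXiv:1106.0483 — 3 statements merged into one kernel-verified Lean document; each statement's English description precedes it below -/
import Mathlib

section
/- For the complete graph K4 and any ρ ∈ (0,1), the Hessian matrix of −S^β evaluated at the interior pseudomarginal point with q_i = 1/2 for all four nodes i and q_{ij} = ρ/2 for all six edges {i,j} is equal to H(ρ). -/
open Real

/-- Single-node entropy `Sᵢ`. -/
noncomputable def nodeEntropy {V : Type*} (q : (V → ℝ) × (Sym2 V → ℝ)) (i : V) : ℝ :=
  negMulLog (q.1 i) + negMulLog (1 - q.1 i)

/-- Pairwise entropy `Sᵢⱼ`. -/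
noncomputable def edgeEntropy {V : Type*} (q : (V → ℝ) × (Sym2 V → ℝ)) (i j : V) : ℝ :=
  negMulLog (q.2 s(i, j)) + negMulLog (q.1 i - q.2 s(i, j)) +
    negMulLog (q.1 j - q.2 s(i, j)) + negMulLog (1 - q.1 i - q.1 j + q.2 s(i, j))

/-- The Bethe entropy `S^β(q) = Σ_{{i,j}∈E} Sᵢⱼ + Σᵢ (1-dᵢ) Sᵢ` (the sum over unordered
edges written as half the sum over ordered adjacent pairs, since `Sᵢⱼ = Sⱼᵢ`). -/
noncomputable def betheEntropy {V : Type*} [Fintype V] (G : SimpleGraph V)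
    [DecidableRel G.Adj] (q : (V → ℝ) × (Sym2 V → ℝ)) : ℝ :=
  (1 / 2) * ∑ i, ∑ j, (if G.Adj i j then edgeEntropy q i j else 0) +
    ∑ i, (1 - (G.degree i : ℝ)) * nodeEntropy q i

/-- The coordinate direction in pseudomarginal space corresponding to node `i`. -/
def nodeDir {V : Type*} [DecidableEq V] (i : V) : (V → ℝ) × (Sym2 V → ℝ) :=
  (Pi.single i 1, 0)

/-- The coordinate direction in pseudomarginal space corresponding to the pair `e`. -/
def edgeDir {V : Type*} [DecidableEq V] (e : Sym2 V) : (V → ℝ) × (Sym2 V → ℝ) :=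
  (0, Pi.single e 1)

/-- The second partial derivative of `f` at `q` in coordinate directions `a`, `b`. -/
noncomputable def pd2 {V : Type*} [Fintype V] [DecidableEq V]
    (f : ((V → ℝ) × (Sym2 V → ℝ)) → ℝ)
    (q a b : (V → ℝ) × (Sym2 V → ℝ)) : ℝ :=
  fderiv ℝ (fun x => fderiv ℝ f x b) q a

/-- The edges of the complete graph `K4`: unordered pairs of distinct vertices. -/
abbrev K4Edge : Type := {e : Sym2 (Fin 4) // ¬ e.IsDiag}

/-- Index type for the `10 × 10` Bethe Hessian of `K4`: 4 nodes and 6 edges. -/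
abbrev K4Index : Type := Fin 4 ⊕ K4Edge

/-- The matrix `H(ρ)`. -/
noncomputable def H (ρ : ℝ) : Matrix K4Index K4Index ℝ := fun a b =>
  match a, b with
  | .inl i, .inl j => if i = j then -8 + 6 / ρ + 6 / (1 - ρ) else 2 / ρ
  | .inl i, .inr e => if i ∈ e.1 then -2 / ρ - 2 / (1 - ρ) else 0
  | .inr e, .inl i => if i ∈ e.1 then -2 / ρ - 2 / (1 - ρ) else 0
  | .inr e, .inr f => if e = f then 4 / ρ + 4 / (1 - ρ) else 0

/-- The coordinate direction corresponding to an index of the Bethe Hessian of `K4`. -/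
def K4Dir : K4Index → (Fin 4 → ℝ) × (Sym2 (Fin 4) → ℝ)
  | .inl i => nodeDir i
  | .inr e => edgeDir e.1

open Filter Topology

section SecondDerivative

variable {E : Type*} [NormedAddCommGroup E] [NormedSpace ℝ E]

/-- `f` is differentiable near `q` and its partial derivative in direction `b` is differentiable
at `q`, with derivative `v` in direction `a`. -/
def HasSecondDerivAlong (f : E → ℝ) (q a b : E) (v : ℝ) : Prop :=
  ∃ f' : E → E →L[ℝ] ℝ, (∀ᶠ x in 𝓝 q, HasFDerivAt f (f' x) x) ∧
    ∃ D : E →L[ℝ] ℝ, HasFDerivAt (fun x => f' x b) D q ∧ D a = v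

namespace HasSecondDerivAlong

variable {f g : E → ℝ} {q a b : E} {v w : ℝ}

lemma fderiv_fderiv_eq (h : HasSecondDerivAlong f q a b v) :
    fderiv ℝ (fun x => fderiv ℝ f x b) q a = v := by
  obtain ⟨f', hf, D, hD, rfl⟩ := h
  have : (fun x => fderiv ℝ f x b) =ᶠ[𝓝 q] fun x => f' x b := by
    filter_upwards [hf] with x hx
    rw [hx.fderiv]
  rw [this.fderiv_eq, hD.fderiv]

lemma add (hf : HasSecondDerivAlong f q a b v) (hg : HasSecondDerivAlong g q a b w) :
    HasSecondDerivAlong (fun x => f x + g x) q a b (v + w) := by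
  obtain ⟨f', hf, D, hD, rfl⟩ := hf
  obtain ⟨g', hg, D', hD', rfl⟩ := hg
  refine ⟨fun x => f' x + g' x, ?_, D + D', hD.add hD', rfl⟩
  filter_upwards [hf, hg] with x hx hx' using hx.add hx'

lemma const_mul (c : ℝ) (hf : HasSecondDerivAlong f q a b v) :
    HasSecondDerivAlong (fun x => c * f x) q a b (c * v) := by
  obtain ⟨f', hf, D, hD, rfl⟩ := hf
  refine ⟨fun x => c • f' x, ?_, c • D, hD.const_mul c, rfl⟩
  filter_upwards [hf] with x hx using hx.const_mul c

lemma neg (hf : HasSecondDerivAlong f q a b v) :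
    HasSecondDerivAlong (fun x => -f x) q a b (-v) := by
  simpa using hf.const_mul (-1)

lemma zero : HasSecondDerivAlong (fun _ => (0 : ℝ)) q a b 0 :=
  ⟨fun _ => 0, .of_forall fun x => hasFDerivAt_const 0 x, 0, hasFDerivAt_const _ _, rfl⟩

lemma sum {ι : Type*} (s : Finset ι) {F : ι → E → ℝ} {V : ι → ℝ}
    (h : ∀ i ∈ s, HasSecondDerivAlong (F i) q a b (V i)) :
    HasSecondDerivAlong (fun x => ∑ i ∈ s, F i x) q a b (∑ i ∈ s, V i) := by
  classical
  induction s using Finset.induction_on with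
  | empty => simpa using zero
  | insert i s hi ih =>
    simp only [Finset.sum_insert hi]
    exact (h i (by simp)).add (ih fun j hj => h j (by simp [hj]))

lemma negMulLog_affine (L : E →L[ℝ] ℝ) (c : ℝ) (h : L q + c ≠ 0) :
    HasSecondDerivAlong (fun x => negMulLog (L x + c)) q a b (-(L a * L b / (L q + c))) := by
  have hL (x : E) : HasFDerivAt (fun x => L x + c) L x := L.hasFDerivAt.add_const c
  refine ⟨fun x => (-log (L x + c) - 1) • L, ?_, L b • -((L q + c)⁻¹ • L), ?_, ?_⟩
  · have hne : ∀ᶠ x in 𝓝 q, L x + c ≠ 0 :=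
      (hL q).continuousAt.eventually_ne h
    filter_upwards [hne] with x hx
    exact (hasDerivAt_negMulLog hx).comp_hasFDerivAt x (hL x)
  · exact (((hL q).log h).neg.sub_const 1).mul_const (L b)
  · simp only [smul_eq_mul, smul_apply, neg_apply]
    ring

end HasSecondDerivAlong

end SecondDerivative

section Bethe

variable {V : Type*} {q : (V → ℝ) × (Sym2 V → ℝ)}

/-- The coordinate functional of a node. -/
noncomputable def nodeCoord (i : V) : (V → ℝ) × (Sym2 V → ℝ) →L[ℝ] ℝ :=
  (ContinuousLinearMap.proj i).comp (ContinuousLinearMap.fst ℝ _ _)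

/-- The coordinate functional of a pair of nodes. -/
noncomputable def pairCoord (e : Sym2 V) : (V → ℝ) × (Sym2 V → ℝ) →L[ℝ] ℝ :=
  (ContinuousLinearMap.proj e).comp (ContinuousLinearMap.snd ℝ _ _)

@[simp] lemma nodeCoord_apply (i : V) (x : (V → ℝ) × (Sym2 V → ℝ)) : nodeCoord i x = x.1 i := rfl

@[simp] lemma pairCoord_apply (e : Sym2 V) (x : (V → ℝ) × (Sym2 V → ℝ)) :
    pairCoord e x = x.2 e := rfl

lemma hasSecondDerivAlong_nodeEntropy [Fintype V] (a b : (V → ℝ) × (Sym2 V → ℝ)) (i : V)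
    (h₀ : q.1 i ≠ 0) (h₁ : 1 - q.1 i ≠ 0) :
    HasSecondDerivAlong (fun x => nodeEntropy x i) q a b
      (-(a.1 i * b.1 i / q.1 i) - a.1 i * b.1 i / (1 - q.1 i)) := by
  have A := HasSecondDerivAlong.negMulLog_affine (q := q) (a := a) (b := b) (nodeCoord i) 0
    (by simpa using h₀)
  have B := HasSecondDerivAlong.negMulLog_affine (q := q) (a := a) (b := b) (-nodeCoord i) 1
    (by simpa [neg_add_eq_sub] using h₁)
  convert A.add B using 1
  · ext x
    simp [nodeEntropy, neg_add_eq_sub]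
  · simp only [neg_apply, nodeCoord_apply, neg_add_eq_sub, add_zero]
    ring

lemma hasSecondDerivAlong_edgeEntropy [Fintype V] (a b : (V → ℝ) × (Sym2 V → ℝ)) (i j : V)
    (h₁₁ : q.2 s(i, j) ≠ 0) (h₁₀ : q.1 i - q.2 s(i, j) ≠ 0) (h₀₁ : q.1 j - q.2 s(i, j) ≠ 0)
    (h₀₀ : 1 - q.1 i - q.1 j + q.2 s(i, j) ≠ 0) :
    HasSecondDerivAlong (fun x => edgeEntropy x i j) q a b
      (-(a.2 s(i, j) * b.2 s(i, j) / q.2 s(i, j) +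
        (a.1 i - a.2 s(i, j)) * (b.1 i - b.2 s(i, j)) / (q.1 i - q.2 s(i, j)) +
        (a.1 j - a.2 s(i, j)) * (b.1 j - b.2 s(i, j)) / (q.1 j - q.2 s(i, j)) +
        (a.2 s(i, j) - a.1 i - a.1 j) * (b.2 s(i, j) - b.1 i - b.1 j) /
          (1 - q.1 i - q.1 j + q.2 s(i, j)))) := by
  have affine (x : (V → ℝ) × (Sym2 V → ℝ)) :
      x.2 s(i, j) - x.1 i - x.1 j + 1 = 1 - x.1 i - x.1 j + x.2 s(i, j) := by ring
  have A := HasSecondDerivAlong.negMulLog_affine (q := q) (a := a) (b := b)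
    (pairCoord s(i, j)) 0 (by simpa using h₁₁)
  have B := HasSecondDerivAlong.negMulLog_affine (q := q) (a := a) (b := b)
    (nodeCoord i - pairCoord s(i, j)) 0 (by simpa using h₁₀)
  have C := HasSecondDerivAlong.negMulLog_affine (q := q) (a := a) (b := b)
    (nodeCoord j - pairCoord s(i, j)) 0 (by simpa using h₀₁)
  have D := HasSecondDerivAlong.negMulLog_affine (q := q) (a := a) (b := b)
    (pairCoord s(i, j) - nodeCoord i - nodeCoord j) 1 (by simpa [affine] using h₀₀)
  convert ((A.add B).add C).add D using 1
  · ext x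
    simp [edgeEntropy, affine]
  · simp only [sub_apply, nodeCoord_apply, pairCoord_apply, affine, add_zero]
    ring

end Bethe

/-- The Hessian of `-S^β` on `K4` at `qᵢ = 1/2`, `qᵢⱼ = ρ/2`, as a bilinear form. -/
noncomputable def hessianForm (ρ : ℝ) (a b : (Fin 4 → ℝ) × (Sym2 (Fin 4) → ℝ)) : ℝ :=
  (∑ i, ∑ j, if i ≠ j then
    (a.2 s(i, j) * b.2 s(i, j) +
      (a.2 s(i, j) - a.1 i - a.1 j) * (b.2 s(i, j) - b.1 i - b.1 j)) / ρ +
    ((a.1 i - a.2 s(i, j)) * (b.1 i - b.2 s(i, j)) +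
      (a.1 j - a.2 s(i, j)) * (b.1 j - b.2 s(i, j))) / (1 - ρ) else 0) -
  8 * ∑ i, a.1 i * b.1 i

lemma hessianForm_comm (ρ : ℝ) (a b : (Fin 4 → ℝ) × (Sym2 (Fin 4) → ℝ)) :
    hessianForm ρ a b = hessianForm ρ b a := by
  simp only [hessianForm, mul_comm]

lemma hessianForm_nodeDir_nodeDir (ρ : ℝ) (i j : Fin 4) :
    hessianForm ρ (nodeDir i) (nodeDir j) = H ρ (.inl i) (.inl j) := by
  simp only [hessianForm, nodeDir, H, Fin.sum_univ_four]
  fin_cases i <;> fin_cases j <;> simp <;> ring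

/-- Summing over ordered pairs of distinct nodes counts each edge twice. -/
lemma sum_edge_indicator (e : K4Edge) (g : Fin 4 → Fin 4 → ℝ) (c : ℝ)
    (hg : ∀ i j, s(i, j) = e.1 → g i j = c) :
    (∑ i, ∑ j, if s(i, j) = e.1 then g i j else 0) = 2 * c := by
  have hcard : ∀ e : K4Edge,
      (Finset.univ.filter fun p : Fin 4 × Fin 4 => s(p.1, p.2) = e.1).card = 2 := by decide
  rw [← Fintype.sum_prod_type', ← Finset.sum_filter,
    Finset.sum_congr rfl fun p hp => hg p.1 p.2 (Finset.mem_filter.1 hp).2,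
    Finset.sum_const, hcard e, nsmul_eq_mul, Nat.cast_ofNat]

lemma hessianForm_nodeDir_edgeDir (ρ : ℝ) (k : Fin 4) (e : K4Edge) :
    hessianForm ρ (nodeDir k) (edgeDir e.1) = H ρ (.inl k) (.inr e) := by
  have hc : H ρ (.inl k) (.inr e) =
      2 * if k ∈ e.1 then -1 / ρ - 1 / (1 - ρ) else 0 := by
    simp only [H]
    split_ifs <;> ring
  rw [hc, ← sum_edge_indicator e
    (fun i j => (-(Pi.single k 1 : Fin 4 → ℝ) i - (Pi.single k 1 : Fin 4 → ℝ) j) *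
      (1 / ρ + 1 / (1 - ρ)))]
  · simp only [hessianForm, nodeDir, edgeDir, Pi.zero_apply, mul_zero, Finset.sum_const_zero,
      sub_zero]
    refine Finset.sum_congr rfl fun i _ => Finset.sum_congr rfl fun j _ => ?_
    by_cases h : s(i, j) = e.1
    · have hij : i ≠ j := fun hij => e.2 (h ▸ Sym2.mk_isDiag_iff.2 hij)
      simp only [h, hij, Pi.single_eq_same, ne_eq, not_false_eq_true, if_true]
      ring
    · simp [h]
  · intro i j h
    have hij : i ≠ j := fun hij => e.2 (h ▸ Sym2.mk_isDiag_iff.2 hij)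
    rw [← h]
    simp only [Pi.single_apply, Sym2.mem_iff, eq_comm (a := k)]
    by_cases hi : i = k <;> by_cases hj : j = k
    · exact absurd (hi.trans hj.symm) hij
    all_goals simp only [hi, hj, or_true, true_or, or_self, if_true, if_false]; ring

lemma hessianForm_edgeDir_edgeDir (ρ : ℝ) (e f : K4Edge) :
    hessianForm ρ (edgeDir e.1) (edgeDir f.1) = H ρ (.inr e) (.inr f) := by
  have hc : H ρ (.inr e) (.inr f) = 2 * if e = f then 2 / ρ + 2 / (1 - ρ) else 0 := by
    simp only [H]
    split_ifs <;> ring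
  rw [hc, ← sum_edge_indicator e (fun _ _ => if e = f then 2 / ρ + 2 / (1 - ρ) else 0) _
    fun _ _ _ => rfl]
  simp only [hessianForm, edgeDir, Pi.zero_apply, mul_zero, Finset.sum_const_zero, sub_zero]
  refine Finset.sum_congr rfl fun i _ => Finset.sum_congr rfl fun j _ => ?_
  by_cases h : s(i, j) = e.1
  · have hij : i ≠ j := fun hij => e.2 (h ▸ Sym2.mk_isDiag_iff.2 hij)
    simp only [h, hij, Pi.single_apply, Subtype.ext_iff, ne_eq, not_false_eq_true, if_true]
    split_ifs <;> ring
  · simp [h]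

/-- The Hessian of `-S^β` on `K4` at `qᵢ = 1/2`, `qᵢⱼ = ρ/2` is `hessianForm ρ`. -/
lemma pd2_neg_betheEntropy_K4 {ρ : ℝ} (h₀ : 0 < ρ) (h₁ : ρ < 1)
    (a b : (Fin 4 → ℝ) × (Sym2 (Fin 4) → ℝ)) :
    pd2 (fun x => -betheEntropy (⊤ : SimpleGraph (Fin 4)) x)
        ((fun _ => 1 / 2, fun _ => ρ / 2) : (Fin 4 → ℝ) × (Sym2 (Fin 4) → ℝ)) a b =
      hessianForm ρ a b := by
  have hρ : ρ ≠ 0 := h₀.ne'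
  have hρ' : 1 - ρ ≠ 0 := by linarith
  set q : (Fin 4 → ℝ) × (Sym2 (Fin 4) → ℝ) := (fun _ => 1 / 2, fun _ => ρ / 2) with hq
  have hE (i j : Fin 4) := hasSecondDerivAlong_edgeEntropy (q := q) a b i j
    (by simp [hq, hρ]) (by simp only [hq]; intro h; apply hρ'; linarith)
    (by simp only [hq]; intro h; apply hρ'; linarith)
    (by simp only [hq]; intro h; apply hρ; linarith)
  have hN (i : Fin 4) := hasSecondDerivAlong_nodeEntropy (q := q) a b i
    (by simp [hq]) (by norm_num [hq])
  have hIte (i j : Fin 4) : HasSecondDerivAlong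
      (fun x => if (⊤ : SimpleGraph (Fin 4)).Adj i j then edgeEntropy x i j else 0) q a b
      (-2 * if i ≠ j then
        (a.2 s(i, j) * b.2 s(i, j) +
          (a.2 s(i, j) - a.1 i - a.1 j) * (b.2 s(i, j) - b.1 i - b.1 j)) / ρ +
        ((a.1 i - a.2 s(i, j)) * (b.1 i - b.2 s(i, j)) +
          (a.1 j - a.2 s(i, j)) * (b.1 j - b.2 s(i, j))) / (1 - ρ) else 0) := by
    by_cases hij : i = j
    · simpa [hij] using HasSecondDerivAlong.zero
    · simp only [SimpleGraph.top_adj, ne_eq, hij, not_false_eq_true, if_true]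
      convert hE i j using 1
      simp only [hq]
      have e₁ : (1 : ℝ) / 2 - ρ / 2 = (1 - ρ) / 2 := by ring
      have e₂ : (1 : ℝ) - 1 / 2 - 1 / 2 + ρ / 2 = ρ / 2 := by ring
      rw [e₁, e₂]
      field_simp
      ring
  have key := (((HasSecondDerivAlong.sum Finset.univ fun i _ =>
    HasSecondDerivAlong.sum Finset.univ fun j _ => hIte i j).const_mul (1 / 2)).add
    (HasSecondDerivAlong.sum Finset.univ fun i _ =>
      (hN i).const_mul (1 - ((⊤ : SimpleGraph (Fin 4)).degree i : ℝ)))).neg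
  refine key.fderiv_fderiv_eq.trans ?_
  have hd (i : Fin 4) : (1 - ((⊤ : SimpleGraph (Fin 4)).degree i : ℝ)) *
      (-(a.1 i * b.1 i / q.1 i) - a.1 i * b.1 i / (1 - q.1 i)) = 8 * (a.1 i * b.1 i) := by
    simp only [SimpleGraph.complete_graph_degree, Fintype.card_fin, hq]
    norm_num
    ring
  simp only [hd, ← Finset.mul_sum, hessianForm]
  ring

/-- For `K4` and any `ρ ∈ (0,1)`, the Hessian of `−S^β` at the pseudomarginal point
`qᵢ = 1/2`, `qᵢⱼ = ρ/2` is equal to `H(ρ)`. -/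
theorem betheHessian_K4_eq_H {ρ : ℝ} (h₀ : 0 < ρ) (h₁ : ρ < 1) :
    ∀ a b : K4Index,
      pd2 (fun x => -betheEntropy (⊤ : SimpleGraph (Fin 4)) x)
        ((fun _ => 1 / 2, fun _ => ρ / 2) : (Fin 4 → ℝ) × (Sym2 (Fin 4) → ℝ))
        (K4Dir a) (K4Dir b) = H ρ a b := by
  intro a b
  rw [pd2_neg_betheEntropy_K4 h₀ h₁]
  rcases a with i | e <;> rcases b with j | f
  · exact hessianForm_nodeDir_nodeDir ρ i j
  · exact hessianForm_nodeDir_edgeDir ρ i f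
  · exact (hessianForm_comm ..).trans (hessianForm_nodeDir_edgeDir ρ j e)
  · exact hessianForm_edgeDir_edgeDir ρ e f
end

section
/- (Pseudo-moment matching.) Let G = (V,E) be a finite simple graph and let p be a point in the interior of the local polytope L(G). Then there exists a unique pair of parameters (h,J) ∈ ℝ^V × ℝ^E such that the gradient of the Bethe free energy F^β_{h,J} vanishes at p; explicitly, J_{ij} = −(1/4) ∂S^β/∂q_{ij}(p) for each edge {i,j} and h_i = Σ_{j ∈ N(i)} J_{ij} − (1/2) ∂S^β/∂q_i(p) for each node i. -/
open Real

/-- The (strict) interior of the local polytope `L(G)`. -/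
def localPolytopeInterior {V : Type*} (G : SimpleGraph V) :
    Set ((V → ℝ) × (Sym2 V → ℝ)) :=
  {q | (∀ i, 0 < q.1 i ∧ q.1 i < 1) ∧
    ∀ i j, G.Adj i j →
      max 0 (q.1 i + q.1 j - 1) < q.2 s(i, j) ∧ q.2 s(i, j) < min (q.1 i) (q.1 j)}

/-- The Bethe free energy `F^β_{h,J}`. -/
noncomputable def betheFreeEnergy {V : Type*} [Fintype V] (G : SimpleGraph V)
    [DecidableRel G.Adj] (h : V → ℝ) (J : Sym2 V → ℝ)
    (q : (V → ℝ) × (Sym2 V → ℝ)) : ℝ :=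
  -∑ i, h i * (2 * q.1 i - 1) -
    (1 / 2) * ∑ i, ∑ j, (if G.Adj i j then
      J s(i, j) * (4 * q.2 s(i, j) - 2 * q.1 i - 2 * q.1 j + 1) else 0) -
    betheEntropy G q

/-- Extend a family of couplings indexed by the edges of `G` to all of `Sym2 V` by zero. -/
noncomputable def extendE {V : Type*} (G : SimpleGraph V) [DecidableRel G.Adj]
    (J : G.edgeSet → ℝ) :
    Sym2 V → ℝ :=
  fun e => if he : e ∈ G.edgeSet then J ⟨e, he⟩ else 0

/-- The linear part of the energy term of the Bethe free energy. -/
noncomputable def betheEnergyLinear {V : Type*} [Fintype V] (G : SimpleGraph V)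
    [DecidableRel G.Adj] (h : V → ℝ) (J : Sym2 V → ℝ) :
    ((V → ℝ) × (Sym2 V → ℝ)) →ₗ[ℝ] ℝ where
  toFun v := -∑ i, h i * (2 * v.1 i) -
    (1 / 2) * ∑ i, ∑ j, (if G.Adj i j then
      J s(i, j) * (4 * v.2 s(i, j) - 2 * v.1 i - 2 * v.1 j) else 0)
  map_add' x y := by
    have h1 : ∑ i, h i * (2 * (x + y).1 i) =
        ∑ i, h i * (2 * x.1 i) + ∑ i, h i * (2 * y.1 i) := by
      rw [← Finset.sum_add_distrib]
      exact Finset.sum_congr rfl fun i _ => by simp; ring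
    have h2 : (∑ i, ∑ j, (if G.Adj i j then
        J s(i, j) * (4 * (x + y).2 s(i, j) - 2 * (x + y).1 i - 2 * (x + y).1 j) else 0)) =
        (∑ i, ∑ j, (if G.Adj i j then
          J s(i, j) * (4 * x.2 s(i, j) - 2 * x.1 i - 2 * x.1 j) else 0)) +
        ∑ i, ∑ j, (if G.Adj i j then
          J s(i, j) * (4 * y.2 s(i, j) - 2 * y.1 i - 2 * y.1 j) else 0) := by
      simp only [← Finset.sum_add_distrib]
      refine Finset.sum_congr rfl fun i _ => Finset.sum_congr rfl fun j _ => ?_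
      split_ifs
      · simp; ring
      · simp
    rw [h1, h2]; ring
  map_smul' c x := by
    simp only [Prod.smul_fst, Prod.smul_snd, Pi.smul_apply, smul_eq_mul, RingHom.id_apply,
      mul_sub, mul_neg, Finset.mul_sum]
    congr 1
    · exact congrArg _ (Finset.sum_congr rfl fun i _ => by ring)
    · refine Finset.sum_congr rfl fun i _ => Finset.sum_congr rfl fun j _ => ?_
      split_ifs <;> ring

theorem betheFreeEnergy_eq {V : Type*} [Fintype V] (G : SimpleGraph V)
    [DecidableRel G.Adj] (h : V → ℝ) (J : Sym2 V → ℝ) (q : (V → ℝ) × (Sym2 V → ℝ)) :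
    betheFreeEnergy G h J q = betheEnergyLinear G h J q +
      (∑ i, h i - (1 / 2) * ∑ i, ∑ j, (if G.Adj i j then J s(i, j) else 0)) -
      betheEntropy G q := by
  have h1 : ∑ i, h i * (2 * q.1 i - 1) = ∑ i, h i * (2 * q.1 i) - ∑ i, h i := by
    rw [← Finset.sum_sub_distrib]
    exact Finset.sum_congr rfl fun i _ => by ring
  have h2 : (∑ i, ∑ j, (if G.Adj i j then
      J s(i, j) * (4 * q.2 s(i, j) - 2 * q.1 i - 2 * q.1 j + 1) else 0)) =
      (∑ i, ∑ j, (if G.Adj i j then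
        J s(i, j) * (4 * q.2 s(i, j) - 2 * q.1 i - 2 * q.1 j) else 0)) +
      ∑ i, ∑ j, (if G.Adj i j then J s(i, j) else 0) := by
    simp only [← Finset.sum_add_distrib]
    refine Finset.sum_congr rfl fun i _ => Finset.sum_congr rfl fun j _ => ?_
    split_ifs <;> ring
  simp only [betheFreeEnergy, betheEnergyLinear, LinearMap.coe_mk, AddHom.coe_mk, h1, h2]
  ring

theorem betheEnergyLinear_edgeDir {V : Type*} [Fintype V] [DecidableEq V] (G : SimpleGraph V)
    [DecidableRel G.Adj] (h : V → ℝ) (J : Sym2 V → ℝ) {i j : V} (hij : G.Adj i j) :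
    betheEnergyLinear G h J (edgeDir s(i, j)) = -4 * J s(i, j) := by
  have key : ∀ a b : V, (if G.Adj a b then
      J s(a, b) * (4 * (Pi.single s(i, j) 1 : Sym2 V → ℝ) s(a, b) - 2 * 0 - 2 * 0) else 0) =
      (if i = a then if j = b then 4 * J s(i, j) else 0 else 0) +
        (if j = a then if i = b then 4 * J s(i, j) else 0 else 0) := by
    intro a b
    have hne := hij.ne
    by_cases hab : s(a, b) = s(i, j)
    · have hadj : G.Adj a b := by
        rw [← SimpleGraph.mem_edgeSet, hab]; exact hij
      rw [if_pos hadj, hab, Pi.single_eq_same]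
      rcases Sym2.eq_iff.mp hab with ⟨rfl, rfl⟩ | ⟨rfl, rfl⟩
      · simp [hne.symm]; ring
      · simp [hne]; ring
    · have h1 : ¬ (i = a ∧ j = b) := fun hh => hab (by rw [hh.1, hh.2])
      have h2 : ¬ (j = a ∧ i = b) := fun hh => hab (by rw [hh.1, hh.2, Sym2.eq_swap])
      rw [Pi.single_eq_of_ne hab, ← ite_and, ← ite_and, if_neg h1, if_neg h2]
      simp
  simp only [betheEnergyLinear, LinearMap.coe_mk, AddHom.coe_mk, edgeDir, Pi.zero_apply, key,
    Finset.sum_add_distrib]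
  simp
  ring

theorem betheEnergyLinear_nodeDir {V : Type*} [Fintype V] [DecidableEq V] (G : SimpleGraph V)
    [DecidableRel G.Adj] (h : V → ℝ) (J : Sym2 V → ℝ) (i : V) :
    betheEnergyLinear G h J (nodeDir i) =
      -2 * h i + 2 * ∑ j ∈ G.neighborFinset i, J s(i, j) := by
  have key : ∀ a b : V, (if G.Adj a b then
      J s(a, b) * (4 * 0 - 2 * (Pi.single i 1 : V → ℝ) a -
        2 * (Pi.single i 1 : V → ℝ) b) else 0) =
      (if a = i then if G.Adj i b then -2 * J s(i, b) else 0 else 0) +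
        (if b = i then if G.Adj i a then -2 * J s(i, a) else 0 else 0) := by
    intro a b
    by_cases ha : a = i <;> by_cases hb : b = i
    · subst ha hb; simp
    · subst ha; simp [hb, mul_comm]
    · subst hb; simp [ha, G.adj_comm a b, Sym2.eq_swap (a := a), mul_comm]
    · simp [ha, hb]
  have hsum : ∑ j ∈ G.neighborFinset i, J s(i, j) =
      ∑ j, if G.Adj i j then J s(i, j) else 0 := by
    rw [← Finset.sum_filter, SimpleGraph.neighborFinset_eq_filter]
  have hsum2 : (∑ j, if G.Adj i j then -2 * J s(i, j) else 0) =
      -2 * ∑ j, if G.Adj i j then J s(i, j) else 0 := by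
    rw [Finset.mul_sum]
    exact Finset.sum_congr rfl fun j _ => by split_ifs <;> ring
  have hone : ∑ a, h a * (2 * (Pi.single i 1 : V → ℝ) a) = 2 * h i := by
    rw [Finset.sum_eq_single i (fun b _ hb => by simp [hb]) (by simp)]
    simp; ring
  have hcol : ∀ a : V, (∑ b, if a = i then if G.Adj i b then -2 * J s(i, b) else 0 else 0) =
      if a = i then ∑ b, if G.Adj i b then -2 * J s(i, b) else 0 else 0 := by
    intro a; split_ifs <;> simp
  simp only [betheEnergyLinear, LinearMap.coe_mk, AddHom.coe_mk, nodeDir, Pi.zero_apply, key,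
    Finset.sum_add_distrib, hone, hcol, Finset.sum_ite_eq', Finset.mem_univ, if_true, hsum,
    hsum2]
  ring

theorem differentiableAt_betheEntropy {V : Type*} [Fintype V] [DecidableEq V]
    (G : SimpleGraph V) [DecidableRel G.Adj] {p : (V → ℝ) × (Sym2 V → ℝ)}
    (hp : p ∈ localPolytopeInterior G) : DifferentiableAt ℝ (betheEntropy G) p := by
  have hneg : ∀ {f : (V → ℝ) × (Sym2 V → ℝ) → ℝ}, DifferentiableAt ℝ f p → f p ≠ 0 →
      DifferentiableAt ℝ (fun q => negMulLog (f q)) p := fun hf h0 =>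
    (Real.differentiableAt_negMulLog h0).comp p hf
  have hn : ∀ i, DifferentiableAt ℝ (fun q : (V → ℝ) × (Sym2 V → ℝ) => q.1 i) p := by
    intro i; fun_prop
  have he : ∀ e, DifferentiableAt ℝ (fun q : (V → ℝ) × (Sym2 V → ℝ) => q.2 e) p := by
    intro e; fun_prop
  unfold betheEntropy
  refine DifferentiableAt.add (.const_mul (.fun_sum fun i _ => .fun_sum fun j _ => ?_) _)
    (.fun_sum fun i _ => .const_mul ?_ _)
  · by_cases hij : G.Adj i j
    · obtain ⟨h1, h2⟩ := hp.2 i j hij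
      rw [max_lt_iff] at h1
      rw [lt_min_iff] at h2
      simp only [hij, if_true, edgeEntropy]
      exact (((hneg (he _) h1.1.ne').add
        (hneg ((hn i).sub (he _)) (sub_pos.mpr h2.1).ne')).add
        (hneg ((hn j).sub (he _)) (sub_pos.mpr h2.2).ne')).add
        (hneg ((((hn i).const_sub 1).sub (hn j)).add (he _)) (by dsimp; linarith [h1.2]))
    · simp [hij]
  · obtain ⟨h1, h2⟩ := hp.1 i
    exact (hneg (hn i) h1.ne').add (hneg ((hn i).const_sub 1) (sub_pos.mpr h2).ne')

theorem betheEntropy_add_smul_edgeDir {V : Type*} [Fintype V] [DecidableEq V]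
    (G : SimpleGraph V) [DecidableRel G.Adj] (p : (V → ℝ) × (Sym2 V → ℝ)) {e : Sym2 V}
    (he : e ∉ G.edgeSet) (t : ℝ) :
    betheEntropy G (p + t • edgeDir e) = betheEntropy G p := by
  have hnode : (p + t • edgeDir e).1 = p.1 := by simp [edgeDir]
  simp only [betheEntropy, nodeEntropy, edgeEntropy, hnode]
  congr 2
  refine Finset.sum_congr rfl fun i _ => Finset.sum_congr rfl fun j _ => ?_
  split_ifs with hij
  · have hne : s(i, j) ≠ e := by
      rintro rfl; exact he hij
    have hedge : (p + t • edgeDir e).2 s(i, j) = p.2 s(i, j) := by simp [edgeDir, hne]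
    rw [hedge]
  · rfl

theorem fderiv_betheEntropy_edgeDir_of_notMem {V : Type*} [Fintype V] [DecidableEq V]
    (G : SimpleGraph V) [DecidableRel G.Adj] {p : (V → ℝ) × (Sym2 V → ℝ)}
    (hp : p ∈ localPolytopeInterior G) {e : Sym2 V} (he : e ∉ G.edgeSet) :
    fderiv ℝ (betheEntropy G) p (edgeDir e) = 0 := by
  rw [← (differentiableAt_betheEntropy G hp).lineDeriv_eq_fderiv, lineDeriv]
  simp only [betheEntropy_add_smul_edgeDir G p he, deriv_const]

theorem betheEnergyLinear_edgeDir_of_notMem {V : Type*} [Fintype V] [DecidableEq V]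
    (G : SimpleGraph V) [DecidableRel G.Adj] (h : V → ℝ) (J : Sym2 V → ℝ) {e : Sym2 V}
    (he : e ∉ G.edgeSet) : betheEnergyLinear G h J (edgeDir e) = 0 := by
  simp only [betheEnergyLinear, LinearMap.coe_mk, AddHom.coe_mk, edgeDir, Pi.zero_apply]
  rw [Finset.sum_eq_zero (by simp), Finset.sum_eq_zero, mul_zero, neg_zero, sub_zero]
  refine fun i _ => Finset.sum_eq_zero fun j _ => ?_
  split_ifs with hij
  · have hne : s(i, j) ≠ e := by
      rintro rfl; exact he hij
    simp [hne]
  · rfl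

/-- Pseudomarginal space is spanned by the node and edge directions. -/
theorem linearMap_ext_nodeDir_edgeDir {V : Type*} [Fintype V] [DecidableEq V]
    {f g : ((V → ℝ) × (Sym2 V → ℝ)) →ₗ[ℝ] ℝ} (hnode : ∀ i, f (nodeDir i) = g (nodeDir i))
    (hedge : ∀ e, f (edgeDir e) = g (edgeDir e)) : f = g := by
  refine LinearMap.prod_ext (LinearMap.pi_ext' fun i => LinearMap.ext_ring ?_)
    (LinearMap.pi_ext' fun e => LinearMap.ext_ring ?_)
  · exact hnode i
  · exact hedge e

/-- The gradient of the Bethe free energy vanishes exactly at the explicit parameters. -/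
theorem fderiv_betheFreeEnergy_eq_zero_iff {V : Type*} [Fintype V] [DecidableEq V]
    (G : SimpleGraph V) [DecidableRel G.Adj] {p : (V → ℝ) × (Sym2 V → ℝ)}
    (hp : p ∈ localPolytopeInterior G) (h : V → ℝ) (J : Sym2 V → ℝ) :
    fderiv ℝ (betheFreeEnergy G h J) p = 0 ↔
      (∀ i j : V, G.Adj i j →
        J s(i, j) = -(1 / 4) * fderiv ℝ (betheEntropy G) p (edgeDir s(i, j))) ∧
      ∀ i : V, h i = (∑ j ∈ G.neighborFinset i, J s(i, j)) -
        (1 / 2) * fderiv ℝ (betheEntropy G) p (nodeDir i) := by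
  have hderiv : fderiv ℝ (betheFreeEnergy G h J) p =
      LinearMap.toContinuousLinearMap (betheEnergyLinear G h J) -
        fderiv ℝ (betheEntropy G) p := by
    rw [funext (betheFreeEnergy_eq G h J)]
    exact (((LinearMap.toContinuousLinearMap (betheEnergyLinear G h J)).hasFDerivAt.add_const
      _).sub (differentiableAt_betheEntropy G hp).hasFDerivAt).fderiv
  rw [hderiv, sub_eq_zero]
  constructor
  · intro heq
    have happ : ∀ v, betheEnergyLinear G h J v = fderiv ℝ (betheEntropy G) p v := fun v =>
      DFunLike.congr_fun heq v
    refine ⟨fun i j hij => ?_, fun i => ?_⟩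
    · rw [← happ, betheEnergyLinear_edgeDir G h J hij]; ring
    · rw [← happ, betheEnergyLinear_nodeDir]; ring
  · rintro ⟨hJ, hh⟩
    apply ContinuousLinearMap.coe_injective
    refine linearMap_ext_nodeDir_edgeDir (fun i => ?_) (fun e => ?_)
    · change betheEnergyLinear G h J (nodeDir i) = fderiv ℝ (betheEntropy G) p (nodeDir i)
      rw [betheEnergyLinear_nodeDir]
      linarith [hh i]
    · change betheEnergyLinear G h J (edgeDir e) = fderiv ℝ (betheEntropy G) p (edgeDir e)
      by_cases he : e ∈ G.edgeSet
      · induction e with | _ i j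
        rw [betheEnergyLinear_edgeDir G h J he]
        linarith [hJ i j he]
      · rw [betheEnergyLinear_edgeDir_of_notMem G h J he,
          fderiv_betheEntropy_edgeDir_of_notMem G hp he]

theorem extendE_of_adj {V : Type*} (G : SimpleGraph V) [DecidableRel G.Adj]
    (J : G.edgeSet → ℝ) {i j : V} (hij : G.Adj i j) :
    extendE G J s(i, j) = J ⟨s(i, j), hij⟩ :=
  dif_pos hij

/-- Pseudo-moment matching: for an interior point `p` of the local polytope there is a
unique pair of parameters `(h, J) ∈ ℝ^V × ℝ^E` for which the gradient of the Bethe free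
energy vanishes at `p`; explicitly `J_{ij} = −(1/4) ∂S^β/∂q_{ij}(p)` on each edge and
`hᵢ = Σ_{j ∈ N(i)} J_{ij} − (1/2) ∂S^β/∂qᵢ(p)` at each node. -/
theorem pseudoMomentMatching {V : Type*} [Fintype V] [DecidableEq V]
    (G : SimpleGraph V) [DecidableRel G.Adj]
    (p : (V → ℝ) × (Sym2 V → ℝ)) (hp : p ∈ localPolytopeInterior G) :
    (∃! hJ : (V → ℝ) × (G.edgeSet → ℝ),
      fderiv ℝ (betheFreeEnergy G hJ.1 (extendE G hJ.2)) p = 0) ∧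
    ∀ hJ : (V → ℝ) × (G.edgeSet → ℝ),
      fderiv ℝ (betheFreeEnergy G hJ.1 (extendE G hJ.2)) p = 0 →
        (∀ i j : V, G.Adj i j →
          extendE G hJ.2 s(i, j) =
            -(1 / 4) * fderiv ℝ (betheEntropy G) p (edgeDir s(i, j))) ∧
        (∀ i : V, hJ.1 i =
          (∑ j ∈ G.neighborFinset i, extendE G hJ.2 s(i, j)) -
            (1 / 2) * fderiv ℝ (betheEntropy G) p (nodeDir i)) := by
  refine ⟨?_, fun hJ h0 => (fderiv_betheFreeEnergy_eq_zero_iff G hp _ _).mp h0⟩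
  let J : G.edgeSet → ℝ := fun e => -(1 / 4) * fderiv ℝ (betheEntropy G) p (edgeDir e)
  let h : V → ℝ := fun i => (∑ j ∈ G.neighborFinset i, extendE G J s(i, j)) -
    (1 / 2) * fderiv ℝ (betheEntropy G) p (nodeDir i)
  refine ⟨(h, J), (fderiv_betheFreeEnergy_eq_zero_iff G hp _ _).mpr
    ⟨fun i j hij => extendE_of_adj G J hij, fun i => rfl⟩, ?_⟩
  rintro ⟨h', J'⟩ h0
  obtain ⟨hJ', hh'⟩ := (fderiv_betheFreeEnergy_eq_zero_iff G hp _ _).mp h0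
  have hJ : J' = J := by
    ext ⟨e, he⟩
    induction e with | _ i j
    exact (extendE_of_adj G J' he).symm.trans (hJ' i j he)
  subst hJ
  exact Prod.ext (funext hh') rfl
end

section
/- (Exactness of the Bethe entropy on trees.) Let G = (V,E) be a finite tree (a connected acyclic simple graph), and for each i ∈ V let X_i be a nonempty finite type. Suppose given probability distributions q_i on X_i with q_i(x) > 0 for all x ∈ X_i, and for each edge {i,j} ∈ E a probability distribution q_{ij} on X_i × X_j whose two one-variable marginals are q_i and q_j. Define Q on Π_{i∈V} X_i by Q(x) = Π_{{i,j}∈E} q_{ij}(x_i, x_j) · Π_{i∈V} q_i(x_i)^{1−d_i}, where d_i is the degree of i. Then: (a) Q is a probability distribution (Σ_x Q(x) = 1 and Q(x) ≥ 0); (b) the single-node marginal of Q at each i is q_i and the pairwise marginal of Q over each edge {i,j} is q_{ij}; and (c) the Shannon entropy of Q equals the Bethe entropy: S[Q] = Σ_{{i,j}∈E} S[q_{ij}] + Σ_{i∈V} (1−d_i) S[q_i]. -/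
open Real

/-- The tree-factorized distribution
`Q(x) = Π_{{i,j}∈E} q_{ij}(x_i, x_j) · Π_i q_i(x_i)^{1−d_i}`
(each unordered edge `{i,j}` enumerated once as the ordered pair with `i < j`). -/
noncomputable def treeFactorization {V : Type*} [Fintype V] [LinearOrder V]
    (G : SimpleGraph V) [DecidableRel G.Adj]
    {X : V → Type*} [∀ i, Fintype (X i)]
    (qV : ∀ i, X i → ℝ) (qE : ∀ i j, X i → X j → ℝ) (x : ∀ v, X v) : ℝ :=
  (∏ i, ∏ j, if i < j ∧ G.Adj i j then qE i j (x i) (x j) else 1) *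
    ∏ i, qV i (x i) ^ ((1 : ℤ) - (G.degree i : ℤ))

namespace SimpleGraph

/-- A rooted tree has a parent function: every edge joins a non-root vertex to its parent, which is
closer to the root. -/
lemma IsTree.exists_parent {V : Type*} {G : SimpleGraph V} (hG : G.IsTree) (r : V) :
    ∃ p : V → V, (∀ v, v ≠ r → G.dist r v = G.dist r (p v) + 1) ∧
      ∀ v w, G.Adj v w ↔ (v ≠ r ∧ p v = w) ∨ (w ≠ r ∧ p w = v) := by
  have hex : ∀ v, ∃ w, v ≠ r → G.Adj w v ∧ G.dist r v = G.dist r w + 1 := by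
    intro v
    by_cases hv : v = r
    · exact ⟨v, fun h => absurd hv h⟩
    obtain ⟨p, hp⟩ := hG.connected.exists_walk_length_eq_dist r v
    have hnil : ¬ p.Nil := Walk.not_nil_of_ne (Ne.symm hv)
    refine ⟨p.penultimate, fun _ => ⟨p.adj_penultimate hnil, ?_⟩⟩
    have h1 : G.dist r p.penultimate ≤ p.length - 1 := by
      simpa using dist_le p.dropLast
    have h2 := hG.dist_eq_dist_add_one_of_adj r (p.adj_penultimate hnil)
    lia
  choose p hp using hex
  have huniq : ∀ v w, G.Adj w v → G.dist r v = G.dist r w + 1 → v ≠ r ∧ p v = w := by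
    intro v w hadj hd
    have hv : v ≠ r := by
      rintro rfl
      simp at hd
    obtain ⟨hadj', hd'⟩ := hp v hv
    refine ⟨hv, ?_⟩
    obtain ⟨a, ha⟩ := hG.connected.exists_walk_length_eq_dist r w
    obtain ⟨b, hb⟩ := hG.connected.exists_walk_length_eq_dist r (p v)
    have ha' : (a.concat hadj).IsPath :=
      Walk.isPath_of_length_eq_dist _ (by rw [Walk.length_concat]; lia)
    have hb' : (b.concat hadj').IsPath :=
      Walk.isPath_of_length_eq_dist _ (by rw [Walk.length_concat]; lia)
    have h := (hG.existsUnique_path r v).unique hb' ha'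
    simpa using congrArg Walk.penultimate h
  refine ⟨p, fun v hv => (hp v hv).2, fun v w => ⟨fun h => ?_, ?_⟩⟩
  · rcases hG.dist_eq_dist_add_one_of_adj r h with hd | hd
    · exact .inl (huniq v w h.symm hd)
    · exact .inr (huniq w v h hd)
  · rintro (⟨hv, rfl⟩ | ⟨hw, rfl⟩)
    · exact (hp v hv).1.symm
    · exact (hp w hw).1

/-- A product over the edges of a rooted tree is a product over its non-root vertices. -/
lemma prod_edges_eq_prod_parent {V M : Type*} [Fintype V] [LinearOrder V] [CommMonoid M]
    (G : SimpleGraph V) [DecidableRel G.Adj] {r : V} {p : V → V}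
    (hdist : ∀ v, v ≠ r → G.dist r v = G.dist r (p v) + 1)
    (hadj : ∀ v w, G.Adj v w ↔ (v ≠ r ∧ p v = w) ∨ (w ≠ r ∧ p w = v))
    (F : V → V → M) (hF : ∀ v w, F v w = F w v) :
    (∏ i, ∏ j, if i < j ∧ G.Adj i j then F i j else 1) = ∏ v ∈ Finset.univ.erase r, F v (p v) := by
  have hexcl : ∀ v w, v ≠ r → p v = w → w ≠ r → p w = v → False := by
    intro v w hv hvw hw hwv
    have h1 := hdist v hv
    have h2 := hdist w hw
    rw [hvw] at h1
    rw [hwv] at h2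
    lia
  have hsplit : ∀ i j, (if i < j ∧ G.Adj i j then F i j else 1) =
      (if i < j ∧ i ≠ r ∧ p i = j then F i j else 1) *
        (if i < j ∧ j ≠ r ∧ p j = i then F j i else 1) := by
    intro i j
    have h := hexcl i j
    have h' := hF i j
    simp only [hadj i j]
    by_cases h1 : i < j <;> by_cases h2 : i ≠ r ∧ p i = j <;> by_cases h3 : j ≠ r ∧ p j = i <;>
      simp [h1, h2, h3, h']
    exact (h h2.1 h2.2 h3.1 h3.2).elim
  have hmerge : ∀ v w, (if v < w ∧ v ≠ r ∧ p v = w then F v w else 1) *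
        (if w < v ∧ v ≠ r ∧ p v = w then F v w else 1) =
      if p v = w then (if v ≠ r then F v w else 1) else 1 := by
    intro v w
    have hne : v ≠ r → p v = w → v ≠ w := by
      rintro hv hw rfl
      exact hexcl v v hv hw hv hw
    by_cases h2 : v = r
    · simp [h2]
    by_cases h3 : p v = w
    · rcases lt_or_gt_of_ne (hne h2 h3) with h | h <;> simp [h2, h3, h, h.not_gt]
    · simp [h3]
  simp_rw [hsplit, Finset.prod_mul_distrib]
  rw [Finset.prod_comm (f := fun i j => if i < j ∧ j ≠ r ∧ p j = i then F j i else 1)]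
  simp_rw [← Finset.prod_mul_distrib, hmerge]
  simp only [Finset.prod_ite_eq, Finset.mem_univ, if_true]
  rw [← Finset.filter_ne', Finset.prod_filter]

/-- Multiplying `f i * f j` over all edges counts each `f i` with multiplicity the degree. -/
lemma prod_edges_mul_eq_prod_pow_degree {V M : Type*} [Fintype V] [LinearOrder V] [CommMonoid M]
    (G : SimpleGraph V) [DecidableRel G.Adj] (f : V → M) :
    (∏ i, ∏ j, if i < j ∧ G.Adj i j then f i * f j else 1) = ∏ i, f i ^ G.degree i := by
  have hsplit : ∀ i j, (if i < j ∧ G.Adj i j then f i * f j else 1) =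
      (if i < j ∧ G.Adj i j then f i else 1) * (if i < j ∧ G.Adj j i then f j else 1) := by
    intro i j
    simp only [G.adj_comm j i]
    split_ifs <;> simp
  have hmerge : ∀ i j, (if i < j ∧ G.Adj i j then f i else 1) *
      (if j < i ∧ G.Adj i j then f i else 1) = if G.Adj i j then f i else 1 := by
    intro i j
    by_cases h : G.Adj i j
    · rcases lt_or_gt_of_ne h.ne with h' | h' <;> simp [h, h', h'.not_gt]
    · simp [h]
  simp_rw [hsplit, Finset.prod_mul_distrib]
  rw [Finset.prod_comm (f := fun i j => if i < j ∧ G.Adj j i then f j else 1)]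
  simp_rw [← Finset.prod_mul_distrib, hmerge]
  refine Finset.prod_congr rfl fun i _ => ?_
  rw [← Finset.prod_filter, Finset.prod_const, ← G.neighborFinset_eq_filter,
    card_neighborFinset_eq_degree]

end SimpleGraph

section ProductMeasure

variable {V : Type*} [Fintype V] [DecidableEq V] {X : V → Type*} [∀ i, Fintype (X i)]

/-- Resampling one coordinate from a distribution leaves a total sum unchanged. -/
lemma sum_eq_sum_mul_sum_update (v : V) (q : X v → ℝ) (hq : ∑ a, q a = 1)
    (h : (∀ i, X i) → ℝ) :
    ∑ x, h x = ∑ x, q (x v) * ∑ a, h (Function.update x v a) := by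
  have hinv : Function.Involutive
      (fun y : (∀ i, X i) × X v => (Function.update y.1 v y.2, y.1 v)) := by
    rintro ⟨x, a⟩
    simp
  simp_rw [Finset.mul_sum]
  rw [← Fintype.sum_prod_type' (f := fun x a => q (x v) * h (Function.update x v a)),
    ← Equiv.sum_comp hinv.toPerm]
  simp only [Function.Involutive.coe_toPerm, Function.update_self, Function.update_idem,
    Function.update_eq_self]
  rw [Fintype.sum_prod_type]
  simp [← Finset.sum_mul, hq]

/-- A factor of conditional mean one in the coordinate `v` integrates out against a product
distribution when the other factor does not depend on that coordinate. -/
lemma sum_prod_mul_mul_eq (qV : ∀ i, X i → ℝ) (v : V) (hq : ∑ a, qV v a = 1)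
    (f k : (∀ i, X i) → ℝ) (hf : ∀ x a, f (Function.update x v a) = f x)
    (hk : ∀ x, ∑ a, qV v a * k (Function.update x v a) = 1) :
    ∑ x, (∏ i, qV i (x i)) * (f x * k x) = ∑ x, (∏ i, qV i (x i)) * f x := by
  rw [sum_eq_sum_mul_sum_update v (qV v) hq]
  refine Finset.sum_congr rfl fun x _ => ?_
  have hw : ∀ a, ∏ i, qV i (Function.update x v a i) =
      qV v a * ∏ i ∈ Finset.univ.erase v, qV i (x i) := by
    intro a
    rw [← Finset.mul_prod_erase _ _ (Finset.mem_univ v), Function.update_self]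
    congr 1
    refine Finset.prod_congr rfl fun i hi => ?_
    rw [Function.update_of_ne (Finset.ne_of_mem_erase hi)]
  have hsum : ∑ a, (∏ i, qV i (Function.update x v a i)) *
      (f (Function.update x v a) * k (Function.update x v a)) =
      (∏ i ∈ Finset.univ.erase v, qV i (x i)) * f x := by
    simp_rw [hw, hf]
    rw [← mul_one ((∏ i ∈ Finset.univ.erase v, qV i (x i)) * f x), ← hk x, Finset.mul_sum]
    exact Finset.sum_congr rfl fun a _ => by ring
  rw [hsum, ← Finset.mul_prod_erase _ _ (Finset.mem_univ v), mul_assoc]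

/-- Factors attached to the vertices of `S`, each of conditional mean one, integrate out in order
of decreasing `ρ` if each factor involves only its vertex and one with smaller `ρ`. -/
lemma sum_prod_mul_prod_eq (qV : ∀ i, X i → ℝ) (hq : ∀ v, ∑ a, qV v a = 1)
    (ρ : V → ℕ) (p : V → V) (k : V → V → (∀ i, X i) → ℝ) (S : Finset V)
    (hρ : ∀ v ∈ S, ρ (p v) < ρ v)
    (hdep : ∀ v w u, u ≠ v → u ≠ w → ∀ x a, k v w (Function.update x u a) = k v w x)
    (hk : ∀ v ∈ S, ∀ x, ∑ a, qV v a * k v (p v) (Function.update x v a) = 1)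
    (f : (∀ i, X i) → ℝ) (hf : ∀ v ∈ S, ∀ x a, f (Function.update x v a) = f x) :
    ∑ x, (∏ i, qV i (x i)) * (f x * ∏ v ∈ S, k v (p v) x) = ∑ x, (∏ i, qV i (x i)) * f x := by
  induction S using Finset.induction_on_max_value ρ with
  | empty => simp
  | insert v s hv hmax ih =>
    simp_rw [Finset.prod_insert hv]
    rw [← ih (fun u hu => hρ u (Finset.mem_insert_of_mem hu))
      (fun u hu => hk u (Finset.mem_insert_of_mem hu))
      (fun u hu => hf u (Finset.mem_insert_of_mem hu)),
      ← sum_prod_mul_mul_eq qV v (hq v) (fun x => f x * ∏ u ∈ s, k u (p u) x) (k v (p v)) ?_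
        (hk v (Finset.mem_insert_self v s))]
    · exact Finset.sum_congr rfl fun x _ => by ring
    · intro x a
      rw [hf v (Finset.mem_insert_self v s)]
      congr 1
      refine Finset.prod_congr rfl fun u hu => hdep u (p u) v ?_ ?_ x a
      · rintro rfl
        exact hv hu
      · intro h
        have h1 := hρ u (Finset.mem_insert_of_mem hu)
        have h2 := hmax u hu
        rw [← h] at h1
        lia

/-- Marginals of a product distribution. -/
lemma sum_prod_mul_indicator [∀ i, DecidableEq (X i)] (qV : ∀ i, X i → ℝ)
    (hq : ∀ v, ∑ a, qV v a = 1) (T : Finset V) (z : ∀ i, X i) :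
    ∑ x : ∀ i, X i, (∏ i, qV i (x i)) * (if ∀ v ∈ T, x v = z v then 1 else 0) =
      ∏ v ∈ T, qV v (z v) := by
  have h1 : ∀ x : ∀ i, X i, (∏ i, qV i (x i)) * (if ∀ v ∈ T, x v = z v then 1 else 0) =
      ∏ i, if i ∈ T then (if x i = z i then qV i (x i) else 0) else qV i (x i) := by
    intro x
    split_ifs with h
    · rw [mul_one]
      refine Finset.prod_congr rfl fun i _ => ?_
      split_ifs with hi hz
      · rfl
      · exact absurd (h i hi) hz
      · rfl
    · push Not at h
      obtain ⟨v, hv, hne⟩ := h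
      rw [mul_zero]
      exact (Finset.prod_eq_zero (Finset.mem_univ v) (by simp [hv, hne])).symm
  simp_rw [h1]
  rw [← Fintype.prod_sum
    (f := fun i a => if i ∈ T then (if a = z i then qV i a else 0) else qV i a)]
  rw [← Finset.prod_subset (Finset.subset_univ T)]
  · refine Finset.prod_congr rfl fun v hv => ?_
    simp [hv]
  · intro v _ hv
    simp [hv, hq]

end ProductMeasure

section TreeFactorization

variable {V : Type*} [Fintype V] [LinearOrder V] (G : SimpleGraph V) [DecidableRel G.Adj]
  {X : V → Type*} [∀ i, Fintype (X i)] (qV : ∀ i, X i → ℝ) (qE : ∀ i j, X i → X j → ℝ)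

lemma treeFactorization_nonneg (hqV_pos : ∀ i a, 0 < qV i a)
    (hqE_nonneg : ∀ i j, G.Adj i j → ∀ a b, 0 ≤ qE i j a b) (x : ∀ v, X v) :
    0 ≤ treeFactorization G qV qE x := by
  refine mul_nonneg (Finset.prod_nonneg fun i _ => Finset.prod_nonneg fun j _ => ?_)
    (Finset.prod_nonneg fun i _ => (zpow_pos (hqV_pos i _) _).le)
  split_ifs with h
  · exact hqE_nonneg i j h.2 _ _
  · exact zero_le_one

/-- The tree factorization as a product distribution times edgewise likelihood ratios. -/
lemma treeFactorization_eq_prod_mul_prod_ratio (hqV_pos : ∀ i a, 0 < qV i a) (x : ∀ v, X v) :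
    treeFactorization G qV qE x = (∏ i, qV i (x i)) *
      ∏ i, ∏ j, if i < j ∧ G.Adj i j then
        qE i j (x i) (x j) / (qV i (x i) * qV j (x j)) else 1 := by
  have hne : ∀ i, qV i (x i) ≠ 0 := fun i => (hqV_pos i _).ne'
  have hdiv : ∀ i j, (if i < j ∧ G.Adj i j then
      qE i j (x i) (x j) / (qV i (x i) * qV j (x j)) else 1) =
      (if i < j ∧ G.Adj i j then qE i j (x i) (x j) else 1) /
        (if i < j ∧ G.Adj i j then qV i (x i) * qV j (x j) else 1) := by
    intro i j
    split_ifs <;> simp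
  simp_rw [hdiv, Finset.prod_div_distrib]
  rw [G.prod_edges_mul_eq_prod_pow_degree (fun i => qV i (x i)), treeFactorization]
  simp_rw [zpow_sub₀ (hne _), zpow_one, zpow_natCast]
  rw [Finset.prod_div_distrib]
  ring

/-- `-Q log Q` expands over the factors of `Q`, also where `Q` vanishes. -/
lemma negMulLog_treeFactorization (hqV_pos : ∀ i a, 0 < qV i a) (x : ∀ v, X v) :
    negMulLog (treeFactorization G qV qE x) =
      (∑ i, ∑ j, if i < j ∧ G.Adj i j then
        treeFactorization G qV qE x * -log (qE i j (x i) (x j)) else 0) +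
      ∑ i, (1 - (G.degree i : ℝ)) * (treeFactorization G qV qE x * -log (qV i (x i))) := by
  by_cases hQ : treeFactorization G qV qE x = 0
  · simp [hQ]
  have hE : (∏ i, ∏ j, if i < j ∧ G.Adj i j then qE i j (x i) (x j) else 1) ≠ 0 :=
    left_ne_zero_of_mul hQ
  have hlog : log (treeFactorization G qV qE x) =
      (∑ i, ∑ j, if i < j ∧ G.Adj i j then log (qE i j (x i) (x j)) else 0) +
      ∑ i, (1 - (G.degree i : ℝ)) * log (qV i (x i)) := by
    rw [treeFactorization, log_mul hE (right_ne_zero_of_mul hQ)]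
    rw [Finset.prod_ne_zero_iff] at hE
    congr 1
    · rw [log_prod fun i hi => hE i hi]
      refine Finset.sum_congr rfl fun i hi => ?_
      rw [log_prod fun j hj => Finset.prod_ne_zero_iff.1 (hE i hi) j hj]
      refine Finset.sum_congr rfl fun j _ => ?_
      split_ifs <;> simp
    · rw [log_prod fun i _ => (zpow_pos (hqV_pos i _) _).ne']
      refine Finset.sum_congr rfl fun i _ => ?_
      rw [log_zpow]
      push_cast
      rfl
  rw [negMulLog, hlog, mul_add, Finset.mul_sum, Finset.mul_sum]
  congr 1
  · refine Finset.sum_congr rfl fun i _ => ?_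
    rw [Finset.mul_sum]
    refine Finset.sum_congr rfl fun j _ => ?_
    split_ifs <;> ring
  · exact Finset.sum_congr rfl fun i _ => by ring

variable [∀ i, DecidableEq (X i)]

/-- The marginal of the tree factorization over the root `r` and a set `T` of its children. -/
lemma sum_treeFactorization_indicator (hqV_pos : ∀ i a, 0 < qV i a)
    (hqV_sum : ∀ i, ∑ a, qV i a = 1) (hqE_symm : ∀ i j a b, qE i j a b = qE j i b a)
    (hqE_marg : ∀ i j, G.Adj i j → ∀ a, ∑ b, qE i j a b = qV i a)
    {r : V} {p : V → V} (hdist : ∀ v, v ≠ r → G.dist r v = G.dist r (p v) + 1)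
    (hadj : ∀ v w, G.Adj v w ↔ (v ≠ r ∧ p v = w) ∨ (w ≠ r ∧ p w = v))
    (T : Finset V) (hr : r ∉ T) (hT : ∀ v ∈ T, p v = r) (z : ∀ i, X i) :
    ∑ x : ∀ i, X i, (if ∀ v ∈ insert r T, x v = z v then treeFactorization G qV qE x else 0) =
      qV r (z r) * ∏ v ∈ T, (qE v r (z v) (z r) / qV r (z r)) := by
  set k : V → V → (∀ i, X i) → ℝ := fun v w x =>
    qE v w (x v) (x w) / (qV v (x v) * qV w (x w)) with hk_def
  have hQ : ∀ x, treeFactorization G qV qE x = (∏ i, qV i (x i)) *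
      ((∏ v ∈ T, k v (p v) x) * ∏ v ∈ Finset.univ.erase r \ T, k v (p v) x) := by
    intro x
    rw [treeFactorization_eq_prod_mul_prod_ratio G qV qE hqV_pos,
      G.prod_edges_eq_prod_parent hdist hadj (fun i j => k i j x)
        (fun v w => by simp only [hk_def]; rw [hqE_symm, mul_comm]),
      mul_comm (∏ v ∈ T, _), Finset.prod_sdiff]
    intro v hv
    exact Finset.mem_erase.2 ⟨fun h => hr (h ▸ hv), Finset.mem_univ v⟩
  set f : (∀ i, X i) → ℝ := fun x => (if ∀ v ∈ insert r T, x v = z v then 1 else 0) *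
    ∏ v ∈ T, k v r z with hf_def
  have hstep : ∀ x, (if ∀ v ∈ insert r T, x v = z v then treeFactorization G qV qE x else 0) =
      (∏ i, qV i (x i)) * (f x * ∏ v ∈ Finset.univ.erase r \ T, k v (p v) x) := by
    intro x
    simp only [hf_def]
    split_ifs with h
    · rw [hQ, one_mul]
      congr 2
      refine Finset.prod_congr rfl fun v hv => ?_
      simp only [hk_def]
      rw [hT v hv, h v (Finset.mem_insert_of_mem hv), h r (Finset.mem_insert_self r T)]
    · simp
  simp_rw [hstep]
  rw [sum_prod_mul_prod_eq qV hqV_sum (G.dist r) p k]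
  · simp_rw [hf_def, ← mul_assoc]
    rw [← Finset.sum_mul, sum_prod_mul_indicator qV hqV_sum, Finset.prod_insert hr, mul_assoc,
      ← Finset.prod_mul_distrib]
    congr 1
    refine Finset.prod_congr rfl fun v _ => ?_
    have h1 := (hqV_pos v (z v)).ne'
    have h2 := (hqV_pos r (z r)).ne'
    simp only [hk_def]
    field_simp
  · intro v hv
    have := hdist v (by simp at hv; exact hv.1)
    lia
  · intro v w u hv hw x a
    simp only [hk_def]
    rw [Function.update_of_ne hv.symm, Function.update_of_ne hw.symm]
  · intro v hv x
    have hvr : v ≠ r := by simp at hv; exact hv.1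
    have hpv : p v ≠ v := by
      intro h
      have := hdist v hvr
      rw [h] at this
      lia
    have hav : G.Adj (p v) v := (hadj _ _).2 (.inr ⟨hvr, rfl⟩)
    simp only [hk_def, Function.update_self, Function.update_of_ne hpv]
    have hb := (hqV_pos (p v) (x (p v))).ne'
    rw [← div_self hb]
    nth_rewrite 2 [← hqE_marg _ _ hav]
    rw [Finset.sum_div]
    refine Finset.sum_congr rfl fun a _ => ?_
    have ha := (hqV_pos v a).ne'
    rw [hqE_symm v (p v)]
    field_simp
  · intro v hv x a
    simp only [hf_def]
    congr 2
    refine propext (forall₂_congr fun u hu => ?_)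
    rw [Function.update_of_ne]
    rintro rfl
    simp at hv hu
    tauto

lemma sum_treeFactorization_single [∀ i, Nonempty (X i)] (hG : G.IsTree)
    (hqV_pos : ∀ i a, 0 < qV i a)
    (hqV_sum : ∀ i, ∑ a, qV i a = 1) (hqE_symm : ∀ i j a b, qE i j a b = qE j i b a)
    (hqE_marg : ∀ i j, G.Adj i j → ∀ a, ∑ b, qE i j a b = qV i a) (i : V) (a : X i) :
    ∑ x : ∀ v, X v, (if x i = a then treeFactorization G qV qE x else 0) = qV i a := by
  obtain ⟨p, hdist, hadj⟩ := hG.exists_parent i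
  have h := sum_treeFactorization_indicator G qV qE hqV_pos hqV_sum hqE_symm hqE_marg hdist hadj
    ∅ (by simp) (by simp) (Function.update (fun _ => Classical.arbitrary _) i a)
  simpa using h

lemma sum_treeFactorization_pair [∀ i, Nonempty (X i)] (hG : G.IsTree)
    (hqV_pos : ∀ i a, 0 < qV i a)
    (hqV_sum : ∀ i, ∑ a, qV i a = 1) (hqE_symm : ∀ i j a b, qE i j a b = qE j i b a)
    (hqE_marg : ∀ i j, G.Adj i j → ∀ a, ∑ b, qE i j a b = qV i a) (i j : V) (hij : G.Adj i j)
    (a : X i) (b : X j) :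
    ∑ x : ∀ v, X v, (if x i = a ∧ x j = b then treeFactorization G qV qE x else 0) =
      qE i j a b := by
  obtain ⟨p, hdist, hadj⟩ := hG.exists_parent i
  have hj : p j = i := by
    rcases (hadj i j).1 hij with h | h
    · exact absurd rfl h.1
    · exact h.2
  have h := sum_treeFactorization_indicator G qV qE hqV_pos hqV_sum hqE_symm hqE_marg hdist hadj
    {j} (by simpa using hij.ne) (by simpa using hj)
    (Function.update (Function.update (fun _ => Classical.arbitrary _) j b) i a)
  have hne := (hqV_pos i a).ne'
  simp only [Finset.forall_mem_insert, Finset.mem_singleton, forall_eq, Function.update_self,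
    Function.update_of_ne hij.ne.symm, Finset.prod_singleton] at h
  rw [h, mul_div_cancel₀ _ hne, hqE_symm]

end TreeFactorization

/-- Summing a weight against a function of a statistic `s` reduces to the law of `s`. -/
lemma sum_mul_comp_eq_sum_law {Ω A : Type*} [Fintype Ω] [Fintype A] [DecidableEq A]
    (Q : Ω → ℝ) (s : Ω → A) (g : A → ℝ) :
    ∑ x, Q x * g (s x) = ∑ a, (∑ x, if s x = a then Q x else 0) * g a := by
  simp_rw [Finset.sum_mul]
  rw [Finset.sum_comm]
  simp [ite_mul]

/-- Exactness of the Bethe entropy on trees: if `G` is a finite tree, the `qᵢ` are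
strictly positive single-node distributions and the `q_{ij}` are edge distributions
marginalizing to them, then `Q(x) = Π_{{i,j}∈E} q_{ij}(x_i,x_j) Π_i q_i(x_i)^{1−dᵢ}`
(a) is a probability distribution, (b) has single-node marginals `qᵢ` and pairwise
marginals `q_{ij}` over the edges, and (c) has Shannon entropy equal to the Bethe
entropy `Σ_{{i,j}∈E} S[q_{ij}] + Σ_i (1−dᵢ) S[qᵢ]`. -/
theorem betheEntropy_exact_on_trees {V : Type*} [Fintype V] [LinearOrder V]
    (G : SimpleGraph V) [DecidableRel G.Adj] (hG : G.IsTree)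
    {X : V → Type*} [∀ i, Fintype (X i)] [∀ i, DecidableEq (X i)] [∀ i, Nonempty (X i)]
    (qV : ∀ i, X i → ℝ) (qE : ∀ i j, X i → X j → ℝ)
    (hqV_pos : ∀ i a, 0 < qV i a)
    (hqV_sum : ∀ i, ∑ a, qV i a = 1)
    (hqE_symm : ∀ i j a b, qE i j a b = qE j i b a)
    (hqE_nonneg : ∀ i j, G.Adj i j → ∀ a b, 0 ≤ qE i j a b)
    (hqE_marg : ∀ i j, G.Adj i j → ∀ a, ∑ b, qE i j a b = qV i a) :
    -- (a) `Q` is a probability distribution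
    ((∀ x, 0 ≤ treeFactorization G qV qE x) ∧
      ∑ x : ∀ v, X v, treeFactorization G qV qE x = 1) ∧
    -- (b) the single-node and pairwise marginals of `Q` are `qᵢ` and `q_{ij}`
    ((∀ (i : V) (a : X i),
        ∑ x : ∀ v, X v, (if x i = a then treeFactorization G qV qE x else 0) = qV i a) ∧
      (∀ i j : V, G.Adj i j → ∀ (a : X i) (b : X j),
        ∑ x : ∀ v, X v,
          (if x i = a ∧ x j = b then treeFactorization G qV qE x else 0) = qE i j a b)) ∧
    -- (c) the Shannon entropy of `Q` equals the Bethe entropy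
    (∑ x : ∀ v, X v, negMulLog (treeFactorization G qV qE x) =
      (∑ i, ∑ j, if i < j ∧ G.Adj i j then ∑ a, ∑ b, negMulLog (qE i j a b) else 0) +
        ∑ i, (1 - (G.degree i : ℝ)) * ∑ a, negMulLog (qV i a)) := by
  have hsingle := sum_treeFactorization_single G qV qE hG hqV_pos hqV_sum hqE_symm hqE_marg
  have hpair := sum_treeFactorization_pair G qV qE hG hqV_pos hqV_sum hqE_symm hqE_marg
  refine ⟨⟨treeFactorization_nonneg G qV qE hqV_pos hqE_nonneg, ?_⟩, ⟨hsingle, hpair⟩, ?_⟩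
  · obtain ⟨i⟩ := hG.connected.nonempty
    have h := sum_mul_comp_eq_sum_law (treeFactorization G qV qE) (fun x => x i) (fun _ => 1)
    simpa [hsingle, hqV_sum] using h
  · simp_rw [negMulLog_treeFactorization G qV qE hqV_pos]
    rw [Finset.sum_add_distrib]
    congr 1
    · rw [Finset.sum_comm]
      refine Finset.sum_congr rfl fun i _ => ?_
      rw [Finset.sum_comm]
      refine Finset.sum_congr rfl fun j _ => ?_
      split_ifs with h
      · rw [sum_mul_comp_eq_sum_law (treeFactorization G qV qE) (fun x => (x i, x j))
          (fun c => -log (qE i j c.1 c.2)), Fintype.sum_prod_type]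
        simp only [Prod.mk.injEq, hpair i j h.2, negMulLog]
        exact Finset.sum_congr rfl fun a _ => Finset.sum_congr rfl fun b _ => by ring
      · simp
    · rw [Finset.sum_comm]
      refine Finset.sum_congr rfl fun i _ => ?_
      rw [← Finset.mul_sum, sum_mul_comp_eq_sum_law (treeFactorization G qV qE) (fun x => x i)
        (fun a => -log (qV i a))]
      simp only [hsingle, negMulLog]
      congr 1
      exact Finset.sum_congr rfl fun a _ => by ring
end
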